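/- Let $H\in(1/2,1)$, $p+H>0$, and let $\sigma:\mathbb{N}\to(0,\infty)$ with $\sigma(i)\sim i^p$ and $\rho:\mathbb{Z}\to[0,\infty)$ even with $\rho(i)\sim\kappa i^{2H-2}$ for some $\kappa>0$. Define $F(\ell_1,\ell_2)=\int_0^{\ell_1}\int_0^{\ell_2}\sigma(\lceil x\rceil)\sigma(\lceil y\rceil)\rho(\lceil x\rceil-\lceil y\rceil)dxdy$. Then $\lim_{u\to\infty}\sup_{b\ge1}\left|\frac{F(u,bu)}{u^{2p+2H}f_{p,H}(1,b)}-\kappa\right|=0$. -/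

import Mathlib

open MeasureTheory Real Set Filter
open scoped ENNReal

/-- `f_{p,H}(a,b) = ∫_0^a ∫_0^b x^p y^p |x-y|^{2H-2} dx dy`. -/
noncomputable def fPH (p H a b : ℝ) : ℝ≥0∞ :=
  ∫⁻ x in Ioo (0:ℝ) a, ∫⁻ y in Ioo (0:ℝ) b,
    ENNReal.ofReal (x ^ p * y ^ p * |x - y| ^ (2 * H - 2))

/-- `F(ℓ₁,ℓ₂) = ∫_0^{ℓ₁} ∫_0^{ℓ₂} σ(⌈x⌉) σ(⌈y⌉) ρ(⌈x⌉-⌈y⌉) dx dy`. -/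
noncomputable def Fcov (σ : ℕ → ℝ) (ρ : ℤ → ℝ) (ℓ₁ ℓ₂ : ℝ) : ℝ :=
  ∫ x in Ioo (0:ℝ) ℓ₁, ∫ y in Ioo (0:ℝ) ℓ₂,
    σ (⌈x⌉.toNat) * σ (⌈y⌉.toNat) * ρ (⌈x⌉ - ⌈y⌉)

/-- If `a n / n ^ s → c`, then `a` may be compared with `t ^ s` at any real `t` within distance
one of `n`. -/
theorem tendsto_div_rpow_of_abs_sub_le_one {α : Type*} {l : Filter α} {a : ℕ → ℝ} {s c : ℝ}
    (ha : Tendsto (fun n : ℕ => a n / (n : ℝ) ^ s) atTop (nhds c)) {n : α → ℕ} {t : α → ℝ}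
    (ht : Tendsto t l atTop) (hnt : ∀ᶠ i in l, |(n i : ℝ) - t i| ≤ 1) :
    Tendsto (fun i => a (n i) / t i ^ s) l (nhds c) := by
  have hn : Tendsto (fun i => (n i : ℝ)) l atTop := by
    refine tendsto_atTop_mono' l ?_ (tendsto_atTop_add_const_right l (-1) ht)
    filter_upwards [hnt] with i hi
    linarith [(abs_le.1 hi).1]
  have hn' : Tendsto n l atTop := tendsto_natCast_atTop_iff.1 hn
  have hratio : Tendsto (fun i => (n i : ℝ) / t i) l (nhds 1) := by
    rw [tendsto_iff_norm_sub_tendsto_zero]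
    refine squeeze_zero' (Eventually.of_forall fun _ => norm_nonneg _) ?_
      (tendsto_inv_atTop_zero.comp ht)
    filter_upwards [hnt, ht.eventually_gt_atTop 0] with i hi hti
    rw [Real.norm_eq_abs, div_sub_one hti.ne', abs_div, abs_of_pos hti]
    simpa [div_eq_mul_inv] using mul_le_of_le_one_left (inv_nonneg.2 hti.le) hi
  have hmul := (ha.comp hn').mul (hratio.rpow_const (p := s) (Or.inl one_ne_zero))
  rw [one_rpow, mul_one] at hmul
  refine hmul.congr' ?_
  filter_upwards [ht.eventually_gt_atTop 0, hn.eventually_gt_atTop 0] with i hti hni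
  have := (rpow_pos_of_pos hni s).ne'
  rw [Function.comp_apply, div_rpow hni.le hti.le]
  field_simp

theorem exists_abs_le_mul_add_one_rpow {a : ℕ → ℝ} {s c : ℝ}
    (ha : Tendsto (fun n : ℕ => a n / (n : ℝ) ^ s) atTop (nhds c)) :
    ∃ C > 0, ∀ n : ℕ, |a n| ≤ C * ((n : ℝ) + 1) ^ s := by
  have h : Tendsto (fun n : ℕ => a n / ((n : ℝ) + 1) ^ s) atTop (nhds c) :=
    tendsto_div_rpow_of_abs_sub_le_one ha (n := id)
      (tendsto_atTop_add_const_right _ 1 tendsto_natCast_atTop_atTop)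
      (Eventually.of_forall fun n => by simp)
  obtain ⟨C, hC, hb⟩ := (Metric.isBounded_range_of_tendsto _ h).exists_pos_norm_le
  refine ⟨C, hC, fun n => ?_⟩
  have hpos : (0 : ℝ) < ((n : ℝ) + 1) ^ s := by positivity
  have := hb _ (mem_range_self n)
  rwa [Real.norm_eq_abs, abs_div, abs_of_pos hpos, div_le_iff₀ hpos] at this

theorem ae_fst_ne_snd : ∀ᵐ z : ℝ × ℝ, z.1 ≠ z.2 := by
  have hm : MeasurableSet {z : ℝ × ℝ | z.1 = z.2} :=
    measurableSet_eq_fun measurable_fst measurable_snd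
  have h0 : volume {z : ℝ × ℝ | z.1 = z.2} = 0 := by
    rw [Measure.volume_eq_prod, Measure.measure_prod_null hm]
    refine Eventually.of_forall fun x => ?_
    have : Prod.mk x ⁻¹' {z : ℝ × ℝ | z.1 = z.2} = {x} := by ext y; simp [eq_comm]
    simp [this]
  exact measure_eq_zero_iff_ae_notMem.1 h0

/-- The homogeneous kernel integrated in `fPH`. -/
noncomputable def powKernel (p H : ℝ) (z : ℝ × ℝ) : ℝ :=
  z.1 ^ p * z.2 ^ p * |z.1 - z.2| ^ (2 * H - 2)

theorem measurable_powKernel (p H : ℝ) : Measurable (powKernel p H) := by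
  unfold powKernel
  fun_prop

theorem powKernel_nonneg (p H : ℝ) {z : ℝ × ℝ} (h₁ : 0 ≤ z.1) (h₂ : 0 ≤ z.2) :
    0 ≤ powKernel p H z := by
  unfold powKernel
  positivity

theorem half_rpow_le {y s : ℝ} (hy : 0 < y) (hs : -1 ≤ s) : (y / 2) ^ s ≤ 2 * y ^ s := by
  rw [div_rpow hy.le zero_le_two, div_eq_mul_inv, ← rpow_neg zero_le_two, mul_comm]
  gcongr
  exact (rpow_le_rpow_of_exponent_le one_le_two (by linarith : -s ≤ 1)).trans_eq (rpow_one 2)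

theorem rpow_mul_rpow_mul_rpow_sub_le {q r β x y : ℝ} (hq : q ≤ 0) (hq' : -1 ≤ q) (hr : r ≤ 0)
    (hr' : -1 ≤ r) (hβ : 2 * q ≤ β) (hx : 0 < x) (hxy : x < y) :
    x ^ q * y ^ q * (y - x) ^ r ≤
      2 * (x ^ (q + r / 2) * y ^ (q + r / 2)) + 2 * (y ^ β * (y - x) ^ (2 * q - β + r)) := by
  have hy : 0 < y := hx.trans hxy
  have hw : 0 < y - x := sub_pos.2 hxy
  rcases le_total x (y / 2) with h | h
  · refine le_add_of_le_of_nonneg ?_ (by positivity)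
    have h1 : (y - x) ^ r ≤ 2 * y ^ r :=
      (rpow_le_rpow_of_nonpos (by positivity) (by linarith) hr).trans (half_rpow_le hy hr')
    have h2 : y ^ (r / 2) ≤ x ^ (r / 2) := rpow_le_rpow_of_nonpos hx hxy.le (by linarith)
    calc x ^ q * y ^ q * (y - x) ^ r ≤ x ^ q * y ^ q * (2 * y ^ r) := by gcongr
      _ = 2 * (x ^ q * y ^ (r / 2) * y ^ (q + r / 2)) := by
        rw [rpow_add hy, ← add_halves r, rpow_add hy]; ring_nf
      _ ≤ 2 * (x ^ q * x ^ (r / 2) * y ^ (q + r / 2)) := by gcongr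
      _ = _ := by rw [rpow_add hx]
  · refine le_add_of_nonneg_of_le (by positivity) ?_
    have h1 : x ^ q ≤ 2 * y ^ q :=
      (rpow_le_rpow_of_nonpos (by positivity) h hq).trans (half_rpow_le hy hq')
    have h2 : y ^ (2 * q - β) ≤ (y - x) ^ (2 * q - β) :=
      rpow_le_rpow_of_nonpos hw (by linarith) (by linarith)
    calc x ^ q * y ^ q * (y - x) ^ r ≤ 2 * y ^ q * y ^ q * (y - x) ^ r := by gcongr
      _ = 2 * (y ^ β * (y ^ (2 * q - β) * (y - x) ^ r)) := by
        rw [← mul_assoc (y ^ β), ← rpow_add hy, mul_assoc 2, ← rpow_add hy]; ring_nf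
      _ ≤ 2 * (y ^ β * ((y - x) ^ (2 * q - β) * (y - x) ^ r)) := by gcongr
      _ = _ := by rw [← rpow_add hw]

theorem integrable_indicator_rpow_mul_indicator_rpow_sub {β γ : ℝ} (hβ : -1 < β) (hγ : -1 < γ)
    {B : ℝ} (hB : 0 < B) :
    Integrable (fun z : ℝ × ℝ => (Ioo 0 B).indicator (fun t : ℝ => t ^ β) z.2 *
      (Ioo 0 B).indicator (fun t : ℝ => t ^ γ) (z.2 - z.1)) := by
  have h (s : ℝ) (hs : -1 < s) : Integrable ((Ioo 0 B).indicator fun t : ℝ => t ^ s) :=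
    ((intervalIntegral.integrableOn_Ioo_rpow_iff hB).2 hs).integrable_indicator measurableSet_Ioo
  simpa [Measure.volume_eq_prod] using
    (h β hβ).convolution_integrand (ContinuousLinearMap.mul ℝ ℝ) (h γ hγ).comp_neg

theorem integrableOn_powKernel_of_nonpos {q H : ℝ} (hH1 : 1 / 2 < H) (hH2 : H < 1)
    (hq : q ≤ 0) (hqH : 0 < q + H) {B : ℝ} (hB : 0 < B) :
    IntegrableOn (powKernel q H) (Ioo 0 B ×ˢ Ioo 0 B) := by
  set r := 2 * H - 2 with hr
  obtain ⟨β, hβ1, hβ2⟩ : ∃ β, max (2 * q) (-1) < β ∧ β < 2 * q + r + 1 :=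
    exists_between (max_lt (by linarith) (by linarith))
  obtain ⟨hβ1, hβ3⟩ := max_lt_iff.1 hβ1
  set φ : ℝ × ℝ → ℝ := fun z => (Ioo 0 B).indicator (fun t : ℝ => t ^ β) z.2 *
      (Ioo 0 B).indicator (fun t : ℝ => t ^ (2 * q - β + r)) (z.2 - z.1) with hφ
  have hφi : Integrable φ :=
    integrable_indicator_rpow_mul_indicator_rpow_sub hβ3 (by linarith) hB
  have hφ0 : ∀ z, 0 ≤ φ z := fun z => mul_nonneg
    (indicator_nonneg (fun t ht => rpow_nonneg ht.1.le _) _)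
    (indicator_nonneg (fun t ht => rpow_nonneg ht.1.le _) _)
  have hφs : Integrable (φ ∘ Prod.swap) := hφi.swap
  have hpow : IntegrableOn (fun t : ℝ => t ^ (q + r / 2)) (Ioo 0 B) :=
    (intervalIntegral.integrableOn_Ioo_rpow_iff hB).2 (by linarith)
  have hψ : IntegrableOn (fun z : ℝ × ℝ => z.1 ^ (q + r / 2) * z.2 ^ (q + r / 2))
      (Ioo 0 B ×ˢ Ioo 0 B) := by
    rw [IntegrableOn, Measure.volume_eq_prod, ← Measure.prod_restrict]
    exact hpow.mul_prod hpow
  have key : ∀ x ∈ Ioo 0 B, ∀ y ∈ Ioo 0 B, x < y → x ^ q * y ^ q * (y - x) ^ r ≤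
      2 * (x ^ (q + r / 2) * y ^ (q + r / 2)) + 2 * φ (x, y) := by
    intro x hx y hy hxy
    have hw : y - x ∈ Ioo 0 B := ⟨by linarith, by linarith [hx.1, hy.2]⟩
    simp only [hφ, indicator_of_mem hy, indicator_of_mem hw]
    exact rpow_mul_rpow_mul_rpow_sub_le hq (by linarith) (by linarith) (by linarith) hβ1.le
      hx.1 hxy
  refine Integrable.mono' (((hψ.const_mul 2).add (hφi.integrableOn.const_mul 2)).add
    (hφs.integrableOn.const_mul 2)) (measurable_powKernel q H).aestronglyMeasurable ?_
  filter_upwards [ae_restrict_mem (measurableSet_Ioo.prod measurableSet_Ioo),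
    ae_restrict_of_ae ae_fst_ne_snd] with z hz hne
  obtain ⟨x, y⟩ := z
  obtain ⟨hx, hy⟩ := hz
  rw [Real.norm_of_nonneg (powKernel_nonneg q H hx.1.le hy.1.le)]
  simp only [Pi.add_apply, Function.comp_apply, Prod.swap_prod_mk, powKernel, ← hr] at hx hy hne ⊢
  rcases hne.lt_or_gt with h | h
  · rw [abs_sub_comm, abs_of_pos (sub_pos.2 h)]
    linarith [key x hx y hy h, hφ0 (y, x)]
  · rw [abs_of_pos (sub_pos.2 h), mul_comm (x ^ q)]
    linarith [key y hy x hx h, hφ0 (x, y), mul_comm (x ^ (q + r / 2)) (y ^ (q + r / 2))]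

/-- On a bounded interval, `x ^ p` is controlled by `x ^ min p 0`. -/
theorem rpow_le_mul_rpow_min (p : ℝ) {x B : ℝ} (hx : 0 < x) (hxB : x ≤ B) :
    x ^ p ≤ B ^ (p - min p 0) * x ^ min p 0 := by
  calc x ^ p = x ^ (p - min p 0) * x ^ min p 0 := by rw [← rpow_add hx]; ring_nf
    _ ≤ _ := by
      gcongr
      linarith [min_le_left p 0]

theorem powKernel_le_mul_powKernel_min (p H : ℝ) {B : ℝ} {z : ℝ × ℝ}
    (hz : z ∈ Ioo 0 B ×ˢ Ioo 0 B) :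
    powKernel p H z ≤ (B ^ (p - min p 0)) ^ 2 * powKernel (min p 0) H z := by
  obtain ⟨⟨hx, hxB⟩, hy, hyB⟩ := hz
  have hB := hx.trans hxB
  calc powKernel p H z ≤ (B ^ (p - min p 0) * z.1 ^ min p 0) *
        (B ^ (p - min p 0) * z.2 ^ min p 0) * |z.1 - z.2| ^ (2 * H - 2) := by
        unfold powKernel
        gcongr
        · exact rpow_le_mul_rpow_min p hx hxB.le
        · exact rpow_le_mul_rpow_min p hy hyB.le
    _ = _ := by unfold powKernel; ring

theorem integrableOn_powKernel_min {p H : ℝ} (hH1 : 1 / 2 < H) (hH2 : H < 1) (hpH : 0 < p + H)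
    {B : ℝ} (hB : 0 < B) : IntegrableOn (powKernel (min p 0) H) (Ioo 0 B ×ˢ Ioo 0 B) :=
  integrableOn_powKernel_of_nonpos hH1 hH2 (min_le_right p 0)
    (by rcases min_choice p 0 with h | h <;> rw [h] <;> linarith) hB

theorem integrableOn_powKernel {p H : ℝ} (hH1 : 1 / 2 < H) (hH2 : H < 1) (hpH : 0 < p + H)
    {B : ℝ} (hB : 0 < B) : IntegrableOn (powKernel p H) (Ioo 0 B ×ˢ Ioo 0 B) := by
  refine Integrable.mono' ((integrableOn_powKernel_min hH1 hH2 hpH hB).const_mul ((B ^ (p - min p 0)) ^ 2))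
    (measurable_powKernel p H).aestronglyMeasurable ?_
  filter_upwards [ae_restrict_mem (measurableSet_Ioo.prod measurableSet_Ioo)] with z hz
  rw [Real.norm_of_nonneg (powKernel_nonneg p H hz.1.1.le hz.2.1.le)]
  exact powKernel_le_mul_powKernel_min p H hz

/-- The function `x ↦ σ(⌈ux⌉)`, rescaled by `u ^ p`. -/
noncomputable def rescaledVar (σ : ℕ → ℝ) (p u x : ℝ) : ℝ := σ ⌈u * x⌉.toNat / u ^ p

/-- The function `(x, y) ↦ ρ(⌈ux⌉ - ⌈uy⌉)`, rescaled by `u ^ (2H - 2)`. -/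
noncomputable def rescaledCorr (ρ : ℤ → ℝ) (H u : ℝ) (z : ℝ × ℝ) : ℝ :=
  ρ (⌈u * z.1⌉ - ⌈u * z.2⌉) / u ^ (2 * H - 2)

/-- The integrand of `Fcov`, rescaled so as to converge to a multiple of `powKernel p H`. -/
noncomputable def rescaledCov (σ : ℕ → ℝ) (ρ : ℤ → ℝ) (p H u : ℝ) (z : ℝ × ℝ) : ℝ :=
  rescaledVar σ p u z.1 * rescaledVar σ p u z.2 * rescaledCorr ρ H u z

theorem measurable_rescaledVar (σ : ℕ → ℝ) (p u : ℝ) : Measurable (rescaledVar σ p u) := by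
  have h : Measurable fun x : ℝ => ⌈u * x⌉ := Int.measurable_ceil.comp (measurable_const_mul u)
  exact ((Measurable.of_discrete (f := fun n : ℤ => σ n.toNat)).comp h).div_const _

theorem measurable_rescaledCorr (ρ : ℤ → ℝ) (H u : ℝ) : Measurable (rescaledCorr ρ H u) := by
  have h : Measurable fun x : ℝ => ⌈u * x⌉ := Int.measurable_ceil.comp (measurable_const_mul u)
  exact ((Measurable.of_discrete (f := ρ)).comp
    ((h.comp measurable_fst).sub (h.comp measurable_snd))).div_const _

theorem measurable_rescaledCov (σ : ℕ → ℝ) (ρ : ℤ → ℝ) (p H u : ℝ) :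
    Measurable (rescaledCov σ ρ p H u) :=
  (((measurable_rescaledVar σ p u).comp measurable_fst).mul
    ((measurable_rescaledVar σ p u).comp measurable_snd)).mul (measurable_rescaledCorr ρ H u)

theorem abs_ceil_toNat_sub_le {t : ℝ} (ht : 0 ≤ t) : |(⌈t⌉.toNat : ℝ) - t| ≤ 1 := by
  rw [Int.ceil_toNat, abs_le]
  constructor <;> linarith [Nat.le_ceil t, Nat.ceil_lt_add_one ht]

theorem abs_natAbs_ceil_sub_ceil_sub_le (s t : ℝ) :
    |((⌈s⌉ - ⌈t⌉).natAbs : ℝ) - (|s - t|)| ≤ 1 := by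
  rw [Nat.cast_natAbs, Int.cast_abs, Int.cast_sub]
  refine (abs_abs_sub_abs_le _ _).trans (abs_le.2 ⟨?_, ?_⟩) <;>
    linarith [Int.le_ceil s, Int.le_ceil t, Int.ceil_lt_add_one s, Int.ceil_lt_add_one t]

theorem apply_eq_apply_natAbs {ρ : ℤ → ℝ} (hρeven : ∀ i, ρ (-i) = ρ i) (n : ℤ) :
    ρ n = ρ (n.natAbs : ℤ) := by
  rcases Int.natAbs_eq n with h | h
  · rw [← h]
  · rw [← hρeven n]
    congr 1
    omega

section Asymptotics

variable {α : Type*} {l : Filter α}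

theorem tendsto_rescaledVar_div_rpow {σ : ℕ → ℝ} {p : ℝ}
    (hσ : Tendsto (fun i : ℕ => σ i / (i : ℝ) ^ p) atTop (nhds 1)) {u x : α → ℝ}
    (hu : ∀ᶠ i in l, 0 < u i) (hx : ∀ᶠ i in l, 0 < x i)
    (hux : Tendsto (fun i => u i * x i) l atTop) :
    Tendsto (fun i => rescaledVar σ p (u i) (x i) / x i ^ p) l (nhds 1) := by
  refine (tendsto_div_rpow_of_abs_sub_le_one hσ (n := fun i => ⌈u i * x i⌉.toNat) hux ?_).congr' ?_
  · filter_upwards [hu, hx] with i hui hxi using abs_ceil_toNat_sub_le (by positivity)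
  · filter_upwards [hu, hx] with i hui hxi
    rw [rescaledVar, mul_rpow hui.le hxi.le, div_div]

theorem tendsto_rescaledCorr_div_rpow {ρ : ℤ → ℝ} {H κ : ℝ} (hρeven : ∀ i, ρ (-i) = ρ i)
    (hρ : Tendsto (fun i : ℕ => ρ (i : ℤ) / (i : ℝ) ^ (2 * H - 2)) atTop (nhds κ))
    {u : α → ℝ} {z : α → ℝ × ℝ} (hu : ∀ᶠ i in l, 0 < u i)
    (huz : Tendsto (fun i => u i * |(z i).1 - (z i).2|) l atTop) :
    Tendsto (fun i => rescaledCorr ρ H (u i) (z i) / |(z i).1 - (z i).2| ^ (2 * H - 2)) l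
      (nhds κ) := by
  refine (tendsto_div_rpow_of_abs_sub_le_one (a := fun n : ℕ => ρ n) hρ
    (n := fun i => (⌈u i * (z i).1⌉ - ⌈u i * (z i).2⌉).natAbs) huz ?_).congr' ?_
  · filter_upwards [hu] with i hui
    simpa [← mul_sub, abs_mul, abs_of_pos hui] using
      abs_natAbs_ceil_sub_ceil_sub_le (u i * (z i).1) (u i * (z i).2)
  · filter_upwards [hu] with i hui
    rw [rescaledCorr, mul_rpow hui.le (abs_nonneg _), div_div,
      apply_eq_apply_natAbs hρeven (_ - _)]

end Asymptotics

theorem tendsto_rescaledVar {σ : ℕ → ℝ} {p : ℝ}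
    (hσ : Tendsto (fun i : ℕ => σ i / (i : ℝ) ^ p) atTop (nhds 1)) {x : ℝ} (hx : 0 < x) :
    Tendsto (fun u => rescaledVar σ p u x) atTop (nhds (x ^ p)) := by
  have h := (tendsto_rescaledVar_div_rpow hσ (u := id) (x := fun _ => x) (eventually_gt_atTop 0)
    (Eventually.of_forall fun _ => hx) (tendsto_id.atTop_mul_const hx)).mul_const (x ^ p)
  rw [one_mul] at h
  exact h.congr fun u => div_mul_cancel₀ _ (rpow_pos_of_pos hx p).ne'

theorem tendsto_rescaledCorr {ρ : ℤ → ℝ} {H κ : ℝ} (hρeven : ∀ i, ρ (-i) = ρ i)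
    (hρ : Tendsto (fun i : ℕ => ρ (i : ℤ) / (i : ℝ) ^ (2 * H - 2)) atTop (nhds κ))
    {z : ℝ × ℝ} (hz : z.1 ≠ z.2) :
    Tendsto (fun u => rescaledCorr ρ H u z) atTop (nhds (κ * |z.1 - z.2| ^ (2 * H - 2))) := by
  have hpos : 0 < |z.1 - z.2| := abs_pos.2 (sub_ne_zero.2 hz)
  exact ((tendsto_rescaledCorr_div_rpow hρeven hρ (u := id) (z := fun _ => z)
    (eventually_gt_atTop 0) (tendsto_id.atTop_mul_const hpos)).mul_const _).congr
      fun u => div_mul_cancel₀ _ (rpow_pos_of_pos hpos _).ne'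

theorem exists_abs_rescaledVar_le {σ : ℕ → ℝ} {p : ℝ}
    (hσ : Tendsto (fun i : ℕ => σ i / (i : ℝ) ^ p) atTop (nhds 1)) {B : ℝ} (hB : 0 < B) :
    ∃ C > 0, ∀ u ≥ 1, ∀ x ∈ Ioo 0 B, |rescaledVar σ p u x| ≤ C * x ^ min p 0 := by
  obtain ⟨C, hC, hσC⟩ := exists_abs_le_mul_add_one_rpow hσ
  refine ⟨C * (B + 2) ^ (p - min p 0), by positivity, fun u hu x hx => ?_⟩
  have hu0 : 0 < u := one_pos.trans_le hu
  have hux : 0 < u * x := mul_pos hu0 hx.1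
  have hn := abs_le.1 (abs_ceil_toNat_sub_le hux.le)
  have hup : 0 < u ^ p := rpow_pos_of_pos hu0 p
  rw [rescaledVar, abs_div, abs_of_pos hup, div_le_iff₀ hup]
  refine (hσC _).trans ?_
  rw [mul_assoc C, mul_assoc C]
  refine mul_le_mul_of_nonneg_left ?_ hC.le
  rcases le_total p 0 with hp | hp
  · rw [min_eq_left hp, sub_self, rpow_zero, one_mul, mul_comm (x ^ p), ← mul_rpow hu0.le hx.1.le]
    exact rpow_le_rpow_of_nonpos hux (by linarith) hp
  · rw [min_eq_right hp, sub_zero, rpow_zero, mul_one, ← mul_rpow (by positivity) hu0.le]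
    refine rpow_le_rpow (by positivity) ?_ hp
    nlinarith [hx.2]

theorem exists_abs_rescaledCorr_le {ρ : ℤ → ℝ} {H κ : ℝ} (hH : H ≤ 1)
    (hρeven : ∀ i, ρ (-i) = ρ i)
    (hρ : Tendsto (fun i : ℕ => ρ (i : ℤ) / (i : ℝ) ^ (2 * H - 2)) atTop (nhds κ)) :
    ∃ C > 0, ∀ u > 0, ∀ z : ℝ × ℝ, z.1 ≠ z.2 →
      |rescaledCorr ρ H u z| ≤ C * |z.1 - z.2| ^ (2 * H - 2) := by
  obtain ⟨C, hC, hρC⟩ := exists_abs_le_mul_add_one_rpow (a := fun n : ℕ => ρ n) hρ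
  refine ⟨C, hC, fun u hu z hz => ?_⟩
  have hpos : 0 < |z.1 - z.2| := abs_pos.2 (sub_ne_zero.2 hz)
  have hup : 0 < u ^ (2 * H - 2) := rpow_pos_of_pos hu _
  have hn := abs_le.1 (abs_natAbs_ceil_sub_ceil_sub_le (u * z.1) (u * z.2))
  rw [← mul_sub, abs_mul, abs_of_pos hu] at hn
  rw [rescaledCorr, abs_div, abs_of_pos hup, div_le_iff₀ hup, apply_eq_apply_natAbs hρeven,
    mul_assoc, ← mul_rpow hpos.le hu.le]
  refine (hρC _).trans (mul_le_mul_of_nonneg_left ?_ hC.le)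
  exact rpow_le_rpow_of_nonpos (by positivity) (by linarith) (by linarith)

theorem exists_abs_rescaledCov_le {σ : ℕ → ℝ} {ρ : ℤ → ℝ} {p H κ : ℝ} (hH : H ≤ 1)
    (hσ : Tendsto (fun i : ℕ => σ i / (i : ℝ) ^ p) atTop (nhds 1))
    (hρeven : ∀ i, ρ (-i) = ρ i)
    (hρ : Tendsto (fun i : ℕ => ρ (i : ℤ) / (i : ℝ) ^ (2 * H - 2)) atTop (nhds κ))
    {B : ℝ} (hB : 0 < B) :
    ∃ C > 0, ∀ u ≥ 1, ∀ z ∈ Ioo 0 B ×ˢ Ioo 0 B, z.1 ≠ z.2 →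
      |rescaledCov σ ρ p H u z| ≤ C * powKernel (min p 0) H z := by
  obtain ⟨C, hC, hσC⟩ := exists_abs_rescaledVar_le hσ hB
  obtain ⟨C', hC', hρC⟩ := exists_abs_rescaledCorr_le hH hρeven hρ
  refine ⟨C ^ 2 * C', by positivity, fun u hu z hz hne => ?_⟩
  have h1 := hσC u hu z.1 hz.1
  have h2 := hσC u hu z.2 hz.2
  have h3 := hρC u (one_pos.trans_le hu) z hne
  rw [rescaledCov, abs_mul, abs_mul]
  calc _ ≤ (C * z.1 ^ min p 0) * (C * z.2 ^ min p 0) * (C' * |z.1 - z.2| ^ (2 * H - 2)) :=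
        mul_le_mul (mul_le_mul h1 h2 (abs_nonneg _) ((abs_nonneg _).trans h1)) h3 (abs_nonneg _)
          (mul_nonneg ((abs_nonneg _).trans h1) ((abs_nonneg _).trans h2))
    _ = _ := by unfold powKernel; ring

theorem ae_restrict_square_mem_and_ne (B : ℝ) :
    ∀ᵐ z : ℝ × ℝ ∂volume.restrict (Ioo 0 B ×ˢ Ioo 0 B),
      z ∈ Ioo 0 B ×ˢ Ioo 0 B ∧ z.1 ≠ z.2 :=
  (ae_restrict_mem (measurableSet_Ioo.prod measurableSet_Ioo)).and (ae_restrict_of_ae ae_fst_ne_snd)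

theorem integrableOn_rescaledCov {σ : ℕ → ℝ} {ρ : ℤ → ℝ} {p H κ : ℝ} (hH1 : 1 / 2 < H)
    (hH2 : H < 1) (hpH : 0 < p + H)
    (hσ : Tendsto (fun i : ℕ => σ i / (i : ℝ) ^ p) atTop (nhds 1))
    (hρeven : ∀ i, ρ (-i) = ρ i)
    (hρ : Tendsto (fun i : ℕ => ρ (i : ℤ) / (i : ℝ) ^ (2 * H - 2)) atTop (nhds κ))
    {B u : ℝ} (hB : 0 < B) (hu : 1 ≤ u) :
    IntegrableOn (rescaledCov σ ρ p H u) (Ioo 0 B ×ˢ Ioo 0 B) := by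
  obtain ⟨C, hC, hb⟩ := exists_abs_rescaledCov_le hH2.le hσ hρeven hρ hB
  refine Integrable.mono' ((integrableOn_powKernel_min hH1 hH2 hpH hB).const_mul C)
    (measurable_rescaledCov σ ρ p H u).aestronglyMeasurable ?_
  filter_upwards [ae_restrict_square_mem_and_ne B] with z hz
  exact hb u hu z hz.1 hz.2

theorem tendsto_integral_abs_rescaledCov_sub {σ : ℕ → ℝ} {ρ : ℤ → ℝ} {p H κ : ℝ}
    (hH1 : 1 / 2 < H) (hH2 : H < 1) (hpH : 0 < p + H)
    (hσ : Tendsto (fun i : ℕ => σ i / (i : ℝ) ^ p) atTop (nhds 1))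
    (hρeven : ∀ i, ρ (-i) = ρ i)
    (hρ : Tendsto (fun i : ℕ => ρ (i : ℤ) / (i : ℝ) ^ (2 * H - 2)) atTop (nhds κ))
    {B : ℝ} (hB : 0 < B) :
    Tendsto (fun u => ∫ z in Ioo 0 B ×ˢ Ioo 0 B,
      |rescaledCov σ ρ p H u z - κ * powKernel p H z|) atTop (nhds 0) := by
  obtain ⟨C, hC, hb⟩ := exists_abs_rescaledCov_le hH2.le hσ hρeven hρ hB
  suffices Tendsto (fun u => ∫ z in Ioo 0 B ×ˢ Ioo 0 B,
      |rescaledCov σ ρ p H u z - κ * powKernel p H z|) atTop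
      (nhds (∫ _ in Ioo 0 B ×ˢ Ioo 0 B, 0)) by rwa [integral_zero] at this
  refine tendsto_integral_filter_of_dominated_convergence
    (fun z => C * powKernel (min p 0) H z + |κ| * powKernel p H z)
    (Eventually.of_forall fun u => ?_) ?_
    (((integrableOn_powKernel_min hH1 hH2 hpH hB).const_mul C).add
      ((integrableOn_powKernel hH1 hH2 hpH hB).const_mul |κ|)) ?_
  · exact ((measurable_rescaledCov σ ρ p H u).sub
      ((measurable_powKernel p H).const_mul κ)).abs.aestronglyMeasurable
  · filter_upwards [eventually_ge_atTop 1] with u hu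
    filter_upwards [ae_restrict_square_mem_and_ne B] with z hz
    rw [Real.norm_eq_abs, abs_abs]
    refine (abs_sub _ _).trans (add_le_add (hb u hu z hz.1 hz.2) ?_)
    rw [abs_mul, abs_of_nonneg (powKernel_nonneg p H hz.1.1.1.le hz.1.2.1.le)]
  · filter_upwards [ae_restrict_square_mem_and_ne B] with z hz
    have h := ((tendsto_rescaledVar hσ hz.1.1.1).mul (tendsto_rescaledVar hσ hz.1.2.1)).mul
      (tendsto_rescaledCorr hρeven hρ hz.2)
    have hlim : z.1 ^ p * z.2 ^ p * (κ * |z.1 - z.2| ^ (2 * H - 2)) = κ * powKernel p H z := by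
      unfold powKernel
      ring
    rw [hlim] at h
    simpa [rescaledCov] using (h.sub_const (κ * powKernel p H z)).abs

theorem tendsto_integral_abs_rescaledVar_sub {σ : ℕ → ℝ} {p : ℝ} (hp : -1 < p)
    (hσ : Tendsto (fun i : ℕ => σ i / (i : ℝ) ^ p) atTop (nhds 1)) :
    Tendsto (fun u => ∫ x in Ioo (0 : ℝ) 1, |rescaledVar σ p u x - x ^ p|) atTop (nhds 0) ∧
      ∀ u ≥ 1, IntegrableOn (fun x => |rescaledVar σ p u x - x ^ p|) (Ioo 0 1) := by
  obtain ⟨C, hC, hb⟩ := exists_abs_rescaledVar_le hσ one_pos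
  have hint (s : ℝ) (hs : -1 < s) : IntegrableOn (fun x : ℝ => x ^ s) (Ioo 0 1) :=
    (intervalIntegral.integrableOn_Ioo_rpow_iff one_pos).2 hs
  have hdom : IntegrableOn (fun x : ℝ => C * x ^ min p 0 + x ^ p) (Ioo 0 1) :=
    ((hint _ (lt_min hp (by norm_num))).const_mul C).add (hint p hp)
  have hmeas (u : ℝ) : AEStronglyMeasurable (fun x => |rescaledVar σ p u x - x ^ p|)
      (volume.restrict (Ioo 0 1)) := by
    have := measurable_rescaledVar σ p u
    exact Measurable.aestronglyMeasurable (by fun_prop)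
  have hle (u : ℝ) (hu : 1 ≤ u) : ∀ᵐ x ∂volume.restrict (Ioo (0 : ℝ) 1),
      ‖|rescaledVar σ p u x - x ^ p|‖ ≤ C * x ^ min p 0 + x ^ p := by
    filter_upwards [ae_restrict_mem measurableSet_Ioo] with x hx
    rw [Real.norm_eq_abs, abs_abs]
    refine (abs_sub _ _).trans (add_le_add (hb u hu x hx) ?_)
    rw [abs_of_nonneg (rpow_nonneg hx.1.le _)]
  refine ⟨?_, fun u hu => Integrable.mono' hdom (hmeas u) (hle u hu)⟩
  suffices Tendsto (fun u => ∫ x in Ioo (0 : ℝ) 1, |rescaledVar σ p u x - x ^ p|) atTop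
      (nhds (∫ _ in Ioo (0 : ℝ) 1, 0)) by rwa [integral_zero] at this
  refine tendsto_integral_filter_of_dominated_convergence _ (Eventually.of_forall hmeas)
    ((eventually_ge_atTop 1).mono hle) hdom ?_
  filter_upwards [ae_restrict_mem measurableSet_Ioo] with x hx
  simpa using ((tendsto_rescaledVar hσ hx.1).sub_const (x ^ p)).abs

theorem setIntegral_Ioo_mul (f : ℝ → ℝ) {u : ℝ} (hu : 0 < u) (b : ℝ) :
    ∫ x in Ioo 0 (u * b), f x = u * ∫ x in Ioo 0 b, f (u * x) := by
  have h := Measure.setIntegral_comp_smul_of_pos volume f (Ioo 0 b) hu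
  rw [LinearOrderedField.smul_Ioo hu, mul_zero] at h
  simp only [smul_eq_mul, Module.finrank_self, pow_one] at h
  rw [h, mul_inv_cancel_left₀ hu.ne']

theorem Fcov_eq_mul_integral_rescaledCov {σ : ℕ → ℝ} {ρ : ℤ → ℝ} {p H u b : ℝ} (hu : 0 < u)
    (hint : IntegrableOn (rescaledCov σ ρ p H u) (Ioo 0 1 ×ˢ Ioo 0 b)) :
    Fcov σ ρ u (b * u) =
      u ^ (2 * p + 2 * H) * ∫ z in Ioo 0 1 ×ˢ Ioo 0 b, rescaledCov σ ρ p H u z := by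
  have hup := (rpow_pos_of_pos hu p).ne'
  have huH := (rpow_pos_of_pos hu (2 * H - 2)).ne'
  have hpow : u ^ (2 * p + 2 * H) = u * u * (u ^ p * u ^ p * u ^ (2 * H - 2)) := by
    rw [← rpow_add hu, ← rpow_add hu, ← sq, ← rpow_natCast, ← rpow_add hu]
    congr 1
    push_cast
    ring
  rw [Measure.volume_eq_prod] at hint ⊢
  rw [setIntegral_prod _ hint, Fcov, mul_comm b u, ← mul_one u, setIntegral_Ioo_mul _ hu 1,
    mul_one]
  simp_rw [setIntegral_Ioo_mul _ hu b]
  rw [hpow, integral_const_mul, ← mul_assoc, mul_assoc (u * u), ← integral_const_mul]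
  simp_rw [← integral_const_mul, rescaledCov, rescaledVar, rescaledCorr]
  congr! 5 with x y
  field_simp

theorem toReal_fPH_eq_integral_powKernel {p H b : ℝ}
    (hint : IntegrableOn (powKernel p H) (Ioo 0 1 ×ˢ Ioo 0 b)) :
    (fPH p H 1 b).toReal = ∫ z in Ioo 0 1 ×ˢ Ioo 0 b, powKernel p H z := by
  rw [integral_eq_lintegral_of_nonneg_ae _ hint.aestronglyMeasurable, Measure.volume_eq_prod,
    ← Measure.prod_restrict, lintegral_prod _
      (measurable_powKernel p H).ennreal_ofReal.aemeasurable]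
  · rfl
  · filter_upwards [ae_restrict_mem (measurableSet_Ioo.prod measurableSet_Ioo)] with z hz
    exact powKernel_nonneg p H hz.1.1.le hz.2.1.le

theorem integral_powKernel_pos {p H : ℝ}
    (hint : IntegrableOn (powKernel p H) (Ioo 0 1 ×ˢ Ioo 0 1)) :
    0 < ∫ z in Ioo 0 1 ×ˢ Ioo 0 1, powKernel p H z := by
  rw [setIntegral_pos_iff_support_of_nonneg_ae (ae_restrict_of_forall_mem
    (measurableSet_Ioo.prod measurableSet_Ioo)
      fun z hz => powKernel_nonneg p H hz.1.1.le hz.2.1.le) hint]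
  refine ((isOpen_Ioo.prod isOpen_Ioo).measure_pos volume
    (U := Ioo (0 : ℝ) (1 / 2) ×ˢ Ioo (1 / 2 : ℝ) 1) ⟨(1 / 4, 3 / 4), by norm_num⟩).trans_le
      (measure_mono ?_)
  rintro ⟨x, y⟩ ⟨⟨hx0, hx⟩, hy, hy1⟩
  simp only at hx0 hx hy hy1
  have hy0 : 0 < y := by linarith
  have hpos : 0 < |x - y| := abs_pos.2 (sub_neg.2 (hx.trans hy)).ne
  have hK : 0 < powKernel p H (x, y) := by
    unfold powKernel
    positivity
  exact ⟨hK.ne', ⟨hx0, by linarith⟩, hy0, hy1⟩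

theorem eventually_abs_mul_sub_le {σ : ℕ → ℝ} {ρ : ℤ → ℝ} {p H κ : ℝ}
    (hσ : Tendsto (fun i : ℕ => σ i / (i : ℝ) ^ p) atTop (nhds 1))
    (hρeven : ∀ i, ρ (-i) = ρ i)
    (hρ : Tendsto (fun i : ℕ => ρ (i : ℤ) / (i : ℝ) ^ (2 * H - 2)) atTop (nhds κ))
    {δ : ℝ} (hδ : 0 < δ) :
    ∀ᶠ u in atTop, ∀ z ∈ Ioo (0 : ℝ) 1 ×ˢ Ici (2 : ℝ),
      |rescaledVar σ p u z.2 / z.2 ^ p *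
        (rescaledCorr ρ H u z / |z.1 - z.2| ^ (2 * H - 2)) - κ| ≤ δ := by
  rw [← eventually_prod_principal_iff (p := fun i : ℝ × ℝ × ℝ =>
    |rescaledVar σ p i.1 i.2.2 / i.2.2 ^ p *
        (rescaledCorr ρ H i.1 i.2 / |i.2.1 - i.2.2| ^ (2 * H - 2)) - κ| ≤ δ)]
  set l := (atTop : Filter ℝ) ×ˢ 𝓟 (Ioo (0 : ℝ) 1 ×ˢ Ici (2 : ℝ))
  have hfst : Tendsto (Prod.fst : ℝ × ℝ × ℝ → ℝ) l atTop := tendsto_fst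
  have hmem : ∀ᶠ i in l, i.2 ∈ Ioo (0 : ℝ) 1 ×ˢ Ici (2 : ℝ) :=
    eventually_prod_principal_iff.2 (Eventually.of_forall fun u z hz => hz)
  have hu : ∀ᶠ i in l, 0 < i.1 := hfst.eventually_gt_atTop 0
  have hy : Tendsto (fun i : ℝ × ℝ × ℝ => i.1 * i.2.2) l atTop := by
    refine tendsto_atTop_mono' l ?_ hfst
    filter_upwards [hmem, hu] with i hi hui
    exact le_mul_of_one_le_right hui.le (one_le_two.trans hi.2)
  have hxy : Tendsto (fun i : ℝ × ℝ × ℝ => i.1 * |i.2.1 - i.2.2|) l atTop := by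
    refine tendsto_atTop_mono' l ?_ hfst
    filter_upwards [hmem, hu] with i hi hui
    refine le_mul_of_one_le_right hui.le (le_abs.2 (Or.inr ?_))
    linarith [hi.1.2, mem_Ici.1 hi.2]
  have hlim := (tendsto_rescaledVar_div_rpow hσ hu (hmem.mono fun i hi => two_pos.trans_le hi.2)
    hy).mul (tendsto_rescaledCorr_div_rpow hρeven hρ hu hxy)
  rw [one_mul] at hlim
  filter_upwards [Metric.tendsto_nhds.1 hlim δ hδ] with i hi
  exact hi.le

/-- Away from the singularities, the rescaled covariance is close to its limit relative to the
limit itself, uniformly in the length of the strip. -/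
theorem eventually_integral_abs_rescaledCov_sub_le {σ : ℕ → ℝ} {ρ : ℤ → ℝ} {p H κ : ℝ}
    (hH1 : 1 / 2 < H) (hH2 : H < 1) (hpH : 0 < p + H) (hκ : 0 ≤ κ)
    (hσ : Tendsto (fun i : ℕ => σ i / (i : ℝ) ^ p) atTop (nhds 1))
    (hρeven : ∀ i, ρ (-i) = ρ i)
    (hρ : Tendsto (fun i : ℕ => ρ (i : ℤ) / (i : ℝ) ^ (2 * H - 2)) atTop (nhds κ))
    {η : ℝ} (hη : 0 < η) :
    ∀ᶠ u in atTop, ∀ b ≥ (2 : ℝ),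
      ∫ z in Ioo 0 1 ×ˢ Ico 2 b, |rescaledCov σ ρ p H u z - κ * powKernel p H z| ≤
        η * ∫ z in Ioo 0 1 ×ˢ Ico 2 b, powKernel p H z := by
  set r := 2 * H - 2 with hr
  obtain ⟨hJ, hJint⟩ := tendsto_integral_abs_rescaledVar_sub (p := p) (by linarith) hσ
  have hIint : IntegrableOn (fun x : ℝ => x ^ p) (Ioo 0 1) :=
    (intervalIntegral.integrableOn_Ioo_rpow_iff one_pos).2 (by linarith)
  set I := ∫ x in Ioo (0 : ℝ) 1, x ^ p with hI
  have hIpos : 0 < I := by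
    rw [hI, ← integral_Ioc_eq_integral_Ioo, ← intervalIntegral.integral_of_le zero_le_one]
    exact intervalIntegral.intervalIntegral_pos_of_pos_on
      (intervalIntegral.intervalIntegrable_rpow' (by linarith)) (fun x hx => rpow_pos_of_pos hx.1 p)
      one_pos
  set δ := min 1 (η / 4) with hδ
  have hδ0 : 0 < δ := lt_min one_pos (by positivity)
  filter_upwards [eventually_abs_mul_sub_le hσ hρeven hρ hδ0, eventually_ge_atTop 1,
    hJ.eventually_le_const (show 0 < η * I / (4 * (κ + 1)) by positivity)] with u huγ hu1 huJ b hb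
  have hb0 : 0 < b := by linarith
  have hsub : Ioo (0 : ℝ) 1 ×ˢ Ico 2 b ⊆ Ioo 0 b ×ˢ Ioo 0 b :=
    Set.prod_mono (Ioo_subset_Ioo le_rfl (by linarith)) fun y hy => ⟨by linarith [hy.1], hy.2⟩
  have hms : MeasurableSet (Ioo (0 : ℝ) 1 ×ˢ Ico 2 b) := measurableSet_Ioo.prod measurableSet_Ico
  have hKint := (integrableOn_powKernel hH1 hH2 hpH hb0).mono_set hsub
  have hGint := (integrableOn_rescaledCov hH1 hH2 hpH hσ hρeven hρ hb0 hu1).mono_set hsub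
  set g : ℝ → ℝ := fun x => 2 * ((κ + 1) * |rescaledVar σ p u x - x ^ p| + δ * x ^ p) with hg
  set h : ℝ → ℝ := fun y => y ^ p * y ^ r with hh
  have hgint : IntegrableOn g (Ioo 0 1) :=
    (((hJint u hu1).const_mul _).add (hIint.const_mul _)).const_mul _
  have hhint : IntegrableOn h (Ico 2 b) := by
    refine (ContinuousOn.integrableOn_Icc fun y hy => ?_).mono_set Ico_subset_Icc_self
    have hy0 : y ≠ 0 := by linarith [hy.1]
    exact ((continuousAt_id.rpow_const (Or.inl hy0)).mul
      (continuousAt_id.rpow_const (Or.inl hy0))).continuousWithinAt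
  have hprod {f : ℝ → ℝ} (hf : IntegrableOn f (Ioo 0 1)) :
      IntegrableOn (fun z : ℝ × ℝ => f z.1 * h z.2) (Ioo 0 1 ×ˢ Ico 2 b) := by
    rw [IntegrableOn, Measure.volume_eq_prod, ← Measure.prod_restrict]
    exact hf.mul_prod hhint
  have hgI : ∫ x in Ioo 0 1, g x ≤ η * I := by
    rw [hg, integral_const_mul, integral_add ((hJint u hu1).const_mul _) (hIint.const_mul _),
      integral_const_mul, integral_const_mul, ← hI]
    rw [le_div_iff₀ (by positivity)] at huJ
    nlinarith [min_le_right 1 (η / 4)]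
  have hh0 : 0 ≤ ∫ y in Ico 2 b, h y := by
    refine setIntegral_nonneg measurableSet_Ico fun y hy => ?_
    have : 0 < y := by linarith [hy.1]
    positivity
  have hupper : ∀ z ∈ Ioo (0 : ℝ) 1 ×ˢ Ico 2 b,
      |rescaledCov σ ρ p H u z - κ * powKernel p H z| ≤ g z.1 * h z.2 := by
    rintro ⟨x, y⟩ ⟨hx, hy⟩
    simp only at hx hy
    have hy0 : 0 < y := by linarith [hy.1]
    have hxp : 0 < x ^ p := rpow_pos_of_pos hx.1 p
    have hyp : 0 < y ^ p := rpow_pos_of_pos hy0 p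
    have hd : y / 2 ≤ |x - y| := le_abs.2 (Or.inr (by linarith [hx.2, hy.1]))
    have hdr : 0 < |x - y| ^ r := rpow_pos_of_pos (by linarith) r
    have hdle : |x - y| ^ r ≤ 2 * y ^ r :=
      (rpow_le_rpow_of_nonpos (by linarith) hd (by linarith)).trans
        (half_rpow_le hy0 (by linarith))
    have hγ := huγ (x, y) ⟨hx, hy.1⟩
    set γ := rescaledVar σ p u y / y ^ p * (rescaledCorr ρ H u (x, y) / |x - y| ^ r) with hγdef
    have hγle : |γ| ≤ κ + 1 := by
      have := abs_le.1 hγ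
      exact abs_le.2 ⟨by linarith [min_le_left 1 (η / 4)], by linarith [min_le_left 1 (η / 4)]⟩
    have heq : rescaledCov σ ρ p H u (x, y) - κ * powKernel p H (x, y) =
        ((rescaledVar σ p u x - x ^ p) * γ + x ^ p * (γ - κ)) * (y ^ p * |x - y| ^ r) := by
      rw [hγdef, rescaledCov, powKernel, ← hr]
      field_simp
      ring
    rw [heq, abs_mul, abs_of_pos (mul_pos hyp hdr)]
    calc _ ≤ ((κ + 1) * |rescaledVar σ p u x - x ^ p| + δ * x ^ p) * (y ^ p * (2 * y ^ r)) := by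
          gcongr
          refine (abs_add_le _ _).trans ?_
          rw [abs_mul _ γ, abs_mul _ (γ - κ), abs_of_pos hxp, mul_comm |_ - _|, mul_comm (x ^ p)]
          gcongr
      _ = _ := by simp only [hg, hh]; ring
  have hlower : ∀ z ∈ Ioo (0 : ℝ) 1 ×ˢ Ico 2 b, z.1 ^ p * h z.2 ≤ powKernel p H z := by
    rintro ⟨x, y⟩ ⟨hx, hy⟩
    simp only [hh, powKernel, ← hr, ← mul_assoc] at hx hy ⊢
    have hy0 : 0 < y := by linarith [hy.1]
    have hx0 := hx.1
    refine mul_le_mul_of_nonneg_left ?_ (by positivity)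
    rw [abs_sub_comm, abs_of_pos (by linarith [hx.2, hy.1])]
    exact rpow_le_rpow_of_nonpos (by linarith [hx.2, hy.1]) (by linarith) (by linarith)
  calc _ ≤ ∫ z in Ioo 0 1 ×ˢ Ico 2 b, g z.1 * h z.2 :=
        setIntegral_mono_on (hGint.sub (hKint.const_mul κ)).abs (hprod hgint) hms hupper
    _ = (∫ x in Ioo 0 1, g x) * ∫ y in Ico 2 b, h y := setIntegral_prod_mul _ _ _ _
    _ ≤ η * I * ∫ y in Ico 2 b, h y := by gcongr
    _ = η * ∫ z in Ioo 0 1 ×ˢ Ico 2 b, z.1 ^ p * h z.2 := by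
        rw [mul_assoc]
        congr 1
        exact (setIntegral_prod_mul (fun x : ℝ => x ^ p) h _ _).symm
    _ ≤ _ := by
        exact mul_le_mul_of_nonneg_left
          (setIntegral_mono_on (hprod hIint) hKint hms hlower) hη.le

theorem stmt_15 (p H κ : ℝ) (hH1 : 1/2 < H) (hH2 : H < 1) (hpH : 0 < p + H) (hκ : 0 < κ)
    (σ : ℕ → ℝ) (ρ : ℤ → ℝ)
    (hσpos : ∀ i, 0 < σ i)
    (hσ : Tendsto (fun i : ℕ => σ i / (i : ℝ) ^ p) atTop (nhds 1))
    (hρnonneg : ∀ i : ℤ, 0 ≤ ρ i) (hρeven : ∀ i : ℤ, ρ (-i) = ρ i)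
    (hρ : Tendsto (fun i : ℕ => ρ (i : ℤ) / (i : ℝ) ^ (2*H - 2)) atTop (nhds κ)) :
    ∀ ε > 0, ∃ U : ℝ, ∀ u ≥ U, ∀ b ≥ (1:ℝ),
      |Fcov σ ρ u (b * u) / (u ^ (2*p + 2*H) * (fPH p H 1 b).toReal) - κ| ≤ ε := by
  intro ε hε
  have hKint {b : ℝ} (hb : 1 ≤ b) : IntegrableOn (powKernel p H) (Ioo 0 1 ×ˢ Ioo 0 b) :=
    (integrableOn_powKernel hH1 hH2 hpH (one_pos.trans_le hb)).mono_set
      (Set.prod_mono (Ioo_subset_Ioo le_rfl hb) le_rfl)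
  have hKnonneg (b : ℝ) : ∀ z ∈ Ioo (0 : ℝ) 1 ×ˢ Ioo 0 b, 0 ≤ powKernel p H z :=
    fun z hz => powKernel_nonneg p H hz.1.1.le hz.2.1.le
  have hKmono {b : ℝ} (hb : 1 ≤ b) {s : Set (ℝ × ℝ)} (hs : s ⊆ Ioo 0 1 ×ˢ Ioo 0 b) :
      ∫ z in s, powKernel p H z ≤ ∫ z in Ioo 0 1 ×ˢ Ioo 0 b, powKernel p H z :=
    setIntegral_mono_set (hKint hb)
      (ae_restrict_of_forall_mem (measurableSet_Ioo.prod measurableSet_Ioo) (hKnonneg b))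
      hs.eventuallyLE
  set f₁ := ∫ z in Ioo 0 1 ×ˢ Ioo 0 1, powKernel p H z with hf₁
  have hf₁pos : 0 < f₁ := integral_powKernel_pos (hKint le_rfl)
  refine eventually_atTop.1 ?_
  filter_upwards [eventually_ge_atTop 1,
    (tendsto_integral_abs_rescaledCov_sub hH1 hH2 hpH hσ hρeven hρ two_pos).eventually_le_const
      (show 0 < ε / 2 * f₁ by positivity),
    eventually_integral_abs_rescaledCov_sub_le hH1 hH2 hpH hκ.le hσ hρeven hρ (half_pos hε)]
    with u hu hnear hfar b hb
  have hu0 : 0 < u := one_pos.trans_le hu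
  have hGint {B : ℝ} (hB : 0 < B) :=
    integrableOn_rescaledCov (p := p) hH1 hH2 hpH hσ hρeven hρ hB hu
  have hsub : Ioo (0 : ℝ) 1 ×ˢ Ioo 0 b ⊆ Ioo 0 b ×ˢ Ioo 0 b :=
    Set.prod_mono (Ioo_subset_Ioo le_rfl hb) le_rfl
  have hGint_b := (hGint (one_pos.trans_le hb)).mono_set hsub
  set D : ℝ × ℝ → ℝ := fun z => |rescaledCov σ ρ p H u z - κ * powKernel p H z| with hD
  have hDint {B : ℝ} (hB : 0 < B) : IntegrableOn D (Ioo 0 B ×ˢ Ioo 0 B) :=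
    ((hGint hB).sub ((integrableOn_powKernel hH1 hH2 hpH hB).const_mul κ)).abs
  have hDnonneg {s : Set (ℝ × ℝ)} : 0 ≤ᵐ[volume.restrict s] D :=
    Eventually.of_forall fun z => abs_nonneg _
  set f := ∫ z in Ioo 0 1 ×ˢ Ioo 0 b, powKernel p H z with hf
  have hf₁f : f₁ ≤ f := hKmono hb (Set.prod_mono le_rfl (Ioo_subset_Ioo le_rfl hb))
  have hfpos : 0 < f := hf₁pos.trans_le hf₁f
  have hDle : ∫ z in Ioo 0 1 ×ˢ Ioo 0 b, D z ≤ ε * f := by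
    have hnear_set {c : ℝ} (hc : c ≤ 2) : ∫ z in Ioo 0 1 ×ˢ Ioo 0 c, D z ≤ ε / 2 * f :=
      (setIntegral_mono_set (hDint two_pos) hDnonneg (Set.prod_mono (Ioo_subset_Ioo le_rfl one_le_two)
        (Ioo_subset_Ioo le_rfl hc)).eventuallyLE).trans (hnear.trans (by gcongr))
    rcases le_total b 2 with hb2 | hb2
    · exact (hnear_set hb2).trans (by nlinarith)
    · have hT : Ioo (0 : ℝ) 1 ×ˢ Ico 2 b ⊆ Ioo 0 1 ×ˢ Ioo 0 b :=
        Set.prod_mono le_rfl fun y hy => ⟨two_pos.trans_le hy.1, hy.2⟩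
      have hunion : Ioo (0 : ℝ) 1 ×ˢ Ioo 0 b = Ioo 0 1 ×ˢ Ioo 0 2 ∪ Ioo 0 1 ×ˢ Ico 2 b := by
        rw [← prod_union, Ioo_union_Ico_eq_Ioo two_pos hb2]
      have hDint_b := (hDint (one_pos.trans_le hb)).mono_set hsub
      have hdisj : Disjoint (Ioo (0 : ℝ) 1 ×ˢ Ioo (0 : ℝ) 2) (Ioo (0 : ℝ) 1 ×ˢ Ico 2 b) :=
        disjoint_prod.2 (Or.inr (disjoint_left.2 fun y hy hy' => hy.2.not_ge hy'.1))
      rw [hunion, setIntegral_union hdisj (measurableSet_Ioo.prod measurableSet_Ico)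
        (hDint_b.mono_set (hunion ▸ subset_union_left)) (hDint_b.mono_set hT)]
      have h1 := hfar b hb2
      have h2 := mul_le_mul_of_nonneg_left (hKmono hb hT) (half_pos hε).le
      linarith [hnear_set le_rfl]
  have hup : u ^ (2 * p + 2 * H) ≠ 0 := (rpow_pos_of_pos hu0 _).ne'
  rw [toReal_fPH_eq_integral_powKernel (hKint hb), Fcov_eq_mul_integral_rescaledCov hu0 hGint_b,
    ← hf, mul_div_mul_left _ _ hup, div_sub' hfpos.ne', abs_div, abs_of_pos hfpos,
    div_le_iff₀ hfpos, mul_comm f κ, hf, ← integral_const_mul,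
    ← integral_sub hGint_b ((hKint hb).const_mul κ)]
  exact (abs_integral_le_integral_abs).trans hDle
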